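/- Suppose d ≤ 2 and fix c ∈ ℭ_+. Define g^c : 𝔓_+ → 𝔓_+ by letting g^c(P) be the unique Q ∈ 𝔓_+ satisfying c_k = ∫_{𝕋^d} e^{i(k,θ)} (P/Q) dm for all k ∈ Λ (i.e., g^c(P) = (f^p)^{−1}(c), where f^p(Q)_k = ∫ e^{i(k,θ)}(P/Q) dm). Then g^c is a diffeomorphism from 𝔓_+ onto its image 𝔔_+ ⊆ 𝔓_+: it is injective, smooth, and its inverse on 𝔔_+ is smooth. -/

import Mathlib

open MeasureTheory Complex Set

noncomputable section

namespace RCE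

/-- The scalar product (k,θ) = Σⱼ kⱼ θⱼ. -/
def dotP (d : ℕ) (k : Fin d → ℤ) (θ : Fin d → ℝ) : ℝ := ∑ j, (k j : ℝ) * θ j

/-- The d-dimensional torus 𝕋^d = (−π,π]^d. -/
def Td (d : ℕ) : Set (Fin d → ℝ) := Set.univ.pi fun _ => Set.Ioc (-Real.pi) Real.pi

/-- Normalized Lebesgue measure dm = (2π)^{-d} dθ on 𝕋^d. -/
def dm (d : ℕ) : Measure (Fin d → ℝ) :=
  (ENNReal.ofReal ((2 * Real.pi) ^ d))⁻¹ • (volume.restrict (Td d))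

/-- Conjugate symmetry of a coefficient sequence indexed by Λ. -/
def symmE (d : ℕ) (Λ : Finset (Fin d → ℤ)) (p : {k // k ∈ Λ} → ℂ) : Prop :=
  ∀ (k : {k // k ∈ Λ}) (h : -(k : Fin d → ℤ) ∈ Λ),
    p ⟨-(k : Fin d → ℤ), h⟩ = starRingEnd ℂ (p k)

/-- Evaluation of the trigonometric polynomial P(e^{iθ}) = Σ_{k∈Λ} p_k e^{-i(k,θ)}. -/
def evalE (d : ℕ) (Λ : Finset (Fin d → ℤ)) (p : {k // k ∈ Λ} → ℂ)
    (θ : Fin d → ℝ) : ℝ :=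
  (∑ k : {k // k ∈ Λ}, p k * Complex.exp (-(dotP d (k : Fin d → ℤ) θ : ℂ) * Complex.I)).re

/-- `𝔓₊` inside the finite-dimensional coefficient space. -/
def PplusE (d : ℕ) (Λ : Finset (Fin d → ℤ)) : Set ({k // k ∈ Λ} → ℂ) :=
  {p | symmE d Λ p ∧ ∀ θ ∈ Td d, 0 < evalE d Λ p θ}

/-- `𝔓̄₊` inside the finite-dimensional coefficient space. -/
def PbarE (d : ℕ) (Λ : Finset (Fin d → ℤ)) : Set ({k // k ∈ Λ} → ℂ) :=
  {p | symmE d Λ p ∧ ∀ θ ∈ Td d, 0 ≤ evalE d Λ p θ}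

/-- The pairing ⟨c,p⟩. -/
def pairE (d : ℕ) (Λ : Finset (Fin d → ℤ)) (c p : {k // k ∈ Λ} → ℂ) : ℝ :=
  (∑ k : {k // k ∈ Λ}, c k * starRingEnd ℂ (p k)).re

/-- `ℭ₊` inside the finite-dimensional coefficient space. -/
def CplusE (d : ℕ) (Λ : Finset (Fin d → ℤ)) : Set ({k // k ∈ Λ} → ℂ) :=
  {c | symmE d Λ c ∧ ∀ p ∈ PbarE d Λ, p ≠ 0 → 0 < pairE d Λ c p}

/-! ### The abstract moment map -/

theorem isInvertible_of_injective {V W : Type*} [NormedAddCommGroup V] [NormedSpace ℝ V]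
    [NormedAddCommGroup W] [NormedSpace ℝ W] [FiniteDimensional ℝ V] [FiniteDimensional ℝ W]
    (h : Module.finrank ℝ V = Module.finrank ℝ W) (L : V →L[ℝ] W) (hL : ∀ v, L v = 0 → v = 0) :
    L.IsInvertible := by
  have hinj : Function.Injective (L : V →ₗ[ℝ] W) := (injective_iff_map_eq_zero _).2 hL
  refine ⟨(LinearMap.linearEquivOfInjective (L : V →ₗ[ℝ] W) hinj h).toContinuousLinearEquiv, ?_⟩
  ext v
  simp

theorem finrank_continuousDual {V : Type*} [NormedAddCommGroup V] [NormedSpace ℝ V]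
    [FiniteDimensional ℝ V] : Module.finrank ℝ V = Module.finrank ℝ (V →L[ℝ] ℝ) := by
  rw [← (LinearMap.toContinuousLinearMap (𝕜 := ℝ) (E := V) (F' := ℝ)).finrank_eq]
  exact (Subspace.dual_finrank_eq (K := ℝ) (V := V)).symm

section MomentMap

variable {K V : Type*} [TopologicalSpace K] [CompactSpace K]
  [NormedAddCommGroup V] [NormedSpace ℝ V]

/-- The moment map `(P, Q) ↦ (R ↦ ℓ (P / Q * R))` attached to a linear family `T` of continuous
functions and a linear functional `ℓ`. -/
def momentMap (T : V →L[ℝ] C(K, ℝ)) (ℓ : C(K, ℝ) →L[ℝ] ℝ) (u : V × V) : V →L[ℝ] ℝ :=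
  (ℓ ∘L (ContinuousLinearMap.mul ℝ C(K, ℝ) (T u.1 * Ring.inverse (T u.2)))) ∘L T

/-- The linear map sending a density `a` to its moments `R ↦ ℓ (a * R)`. -/
def momentCLM (T : V →L[ℝ] C(K, ℝ)) (ℓ : C(K, ℝ) →L[ℝ] ℝ) : C(K, ℝ) →L[ℝ] V →L[ℝ] ℝ :=
  (ContinuousLinearMap.compL ℝ V C(K, ℝ) ℝ).flip T ∘L
    (ContinuousLinearMap.compL ℝ C(K, ℝ) C(K, ℝ) ℝ ℓ) ∘L ContinuousLinearMap.mul ℝ C(K, ℝ)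

/-- The linear map `P ↦ momentMap (P, Q)`. -/
def momentLeft (T : V →L[ℝ] C(K, ℝ)) (ℓ : C(K, ℝ) →L[ℝ] ℝ) (Q : V) : V →L[ℝ] V →L[ℝ] ℝ :=
  momentCLM T ℓ ∘L ContinuousLinearMap.mul ℝ C(K, ℝ) (Ring.inverse (T Q)) ∘L T

variable {T : V →L[ℝ] C(K, ℝ)} {ℓ : C(K, ℝ) →L[ℝ] ℝ}

@[simp]
theorem momentCLM_apply (a : C(K, ℝ)) (v : V) : momentCLM T ℓ a v = ℓ (a * T v) := rfl

theorem momentMap_eq (u : V × V) :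
    momentMap T ℓ u = momentCLM T ℓ (T u.1 * Ring.inverse (T u.2)) := rfl

omit [CompactSpace K] in
theorem isUnit_of_pos {f : C(K, ℝ)} (hf : ∀ x, 0 < f x) : IsUnit f :=
  (ContinuousMap.isUnit_iff_forall_ne_zero f).2 fun x => (hf x).ne'

omit [CompactSpace K] in
theorem ringInverse_apply {f : C(K, ℝ)} (hf : ∀ x, 0 < f x) (x : K) :
    Ring.inverse f x = (f x)⁻¹ := by
  have h := DFunLike.congr_fun (Ring.mul_inverse_cancel f (isUnit_of_pos hf)) x
  exact eq_inv_of_mul_eq_one_right (by simpa using h)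

omit [CompactSpace K] in
theorem ringInverse_pos {f : C(K, ℝ)} (hf : ∀ x, 0 < f x) (x : K) : 0 < Ring.inverse f x := by
  rw [ringInverse_apply hf]
  exact inv_pos.2 (hf x)

theorem contDiffAt_ringInverse_comp {Q : V} (hQ : ∀ x, 0 < T Q x) {n : ℕ∞} :
    ContDiffAt ℝ n (fun q : V => Ring.inverse (T q)) Q := by
  obtain ⟨u, hu⟩ := isUnit_of_pos hQ
  have h := contDiffAt_ringInverse (n := n) ℝ u
  rw [hu] at h
  exact h.comp Q T.contDiff.contDiffAt

theorem contDiffAt_momentMap {u : V × V} (hQ : ∀ x, 0 < T u.2 x) {n : ℕ∞} :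
    ContDiffAt ℝ n (momentMap T ℓ) u := by
  have h1 : ContDiffAt ℝ n (fun u : V × V => T u.1) u :=
    T.contDiff.contDiffAt.comp u contDiffAt_fst
  have h2 : ContDiffAt ℝ n (fun u : V × V => Ring.inverse (T u.2)) u :=
    (contDiffAt_ringInverse_comp hQ).comp u contDiffAt_snd
  exact (momentCLM T ℓ).contDiff.contDiffAt.comp u (h1.mul h2)

theorem hasFDerivAt_ringInverse_comp {Q : V} (hQ : ∀ x, 0 < T Q x) :
    HasFDerivAt (fun q : V => Ring.inverse (T q))
      (-(ContinuousLinearMap.mul ℝ C(K, ℝ) (Ring.inverse (T Q) * Ring.inverse (T Q))) ∘L T) Q := by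
  obtain ⟨u, hu⟩ := isUnit_of_pos hQ
  have h := hasFDerivAt_ringInverse (𝕜 := ℝ) u
  rw [hu] at h
  refine (h.comp Q T.hasFDerivAt).congr_fderiv ?_
  ext v x
  simp only [← hu, Ring.inverse_unit]
  simp
  ring

theorem fderiv_momentMap_comp_inr_apply {u : V × V} (hQ : ∀ x, 0 < T u.2 x) (v : V) :
    (fderiv ℝ (momentMap T ℓ) u ∘L .inr ℝ V V) v =
      -momentCLM T ℓ (T u.1 * (Ring.inverse (T u.2) * Ring.inverse (T u.2)) * T v) := by
  have h1 : HasFDerivAt (fun q => momentMap T ℓ (u.1, q))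
      (fderiv ℝ (momentMap T ℓ) u ∘L .inr ℝ V V) u.2 :=
    HasFDerivAt.comp (g := momentMap T ℓ) (f := fun q => (u.1, q)) u.2
      ((contDiffAt_momentMap (n := 1) hQ).differentiableAt (by simp)).hasFDerivAt
      (hasFDerivAt_prodMk_right u.1 u.2)
  have h2 : HasFDerivAt (fun q => momentMap T ℓ (u.1, q)) _ u.2 :=
    (momentCLM T ℓ ∘L ContinuousLinearMap.mul ℝ C(K, ℝ) (T u.1)).hasFDerivAt.comp u.2
      (hasFDerivAt_ringInverse_comp hQ)
  rw [h1.unique h2]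
  ext w
  simp [mul_assoc]

theorem isOpen_pos : IsOpen {v : V | ∀ x, 0 < T v x} := by
  have h : IsOpen {f : C(K, ℝ) | Set.MapsTo f univ (Ioi 0)} :=
    ContinuousMap.isOpen_setOfPred_mapsTo isCompact_univ isOpen_Ioi
  simpa [Set.MapsTo] using h.preimage T.continuous

variable (hℓ : ∀ (w : C(K, ℝ)) (v : V), (∀ x, 0 < w x) → ℓ (w * T v * T v) = 0 → v = 0)
include hℓ

theorem momentCLM_injective {w : C(K, ℝ)} (hw : ∀ x, 0 < w x) {v : V}
    (h : momentCLM T ℓ (w * T v) = 0) : v = 0 :=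
  hℓ w v hw (by simpa using DFunLike.congr_fun h v)

theorem momentMap_injective_right {P Q₁ Q₂ : V} (hP : ∀ x, 0 < T P x) (h₁ : ∀ x, 0 < T Q₁ x)
    (h₂ : ∀ x, 0 < T Q₂ x) (h : momentMap T ℓ (P, Q₁) = momentMap T ℓ (P, Q₂)) : Q₁ = Q₂ := by
  have hw : ∀ x, 0 < (T P * (Ring.inverse (T Q₁) * Ring.inverse (T Q₂))) x := fun x =>
    mul_pos (hP x) (mul_pos (ringInverse_pos h₁ x) (ringInverse_pos h₂ x))
  refine (sub_eq_zero.1 (momentCLM_injective hℓ hw ?_)).symm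
  rw [momentMap_eq, momentMap_eq, ← sub_eq_zero, ← map_sub] at h
  convert h using 2
  ext x
  simp only [ContinuousMap.mul_apply, ContinuousMap.sub_apply, map_sub, ringInverse_apply h₁,
    ringInverse_apply h₂]
  have := (h₁ x).ne'
  have := (h₂ x).ne'
  field_simp

variable [FiniteDimensional ℝ V]

theorem exists_smooth_left_inverse (c : V →L[ℝ] ℝ) :
    ∃ h : V → V, ContDiffOn ℝ (⊤ : ℕ∞) h {v | ∀ x, 0 < T v x} ∧
      ∀ P Q, (∀ x, 0 < T Q x) → momentMap T ℓ (P, Q) = c → h Q = P := by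
  have hinv : ∀ Q, (∀ x, 0 < T Q x) → (momentLeft T ℓ Q).IsInvertible := fun Q hQ =>
    isInvertible_of_injective finrank_continuousDual _ fun v hv =>
      momentCLM_injective hℓ (ringInverse_pos hQ) hv
  refine ⟨fun Q => (momentLeft T ℓ Q).inverse c, fun Q hQ => ?_, fun P Q hQ h => ?_⟩
  · have h1 : ContDiffAt ℝ (⊤ : ℕ∞) (momentLeft T ℓ) Q := by
      have h2 := contDiffAt_ringInverse_comp hQ (n := ⊤)
      unfold momentLeft
      fun_prop
    exact (((hinv Q hQ).contDiffAt_map_inverse.comp Q h1).clm_apply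
      contDiffAt_const).contDiffWithinAt
  · have h1 : momentLeft T ℓ Q P = c := by
      rw [← h, momentMap_eq, mul_comm]
      rfl
    obtain ⟨e, he⟩ := hinv Q hQ
    simp only [← he] at h1 ⊢
    simp [← h1]

theorem contDiffOn_of_momentMap_eq (c : V →L[ℝ] ℝ) (g : V → V)
    (hg : ∀ P, (∀ x, 0 < T P x) → (∀ x, 0 < T (g P) x) ∧ momentMap T ℓ (P, g P) = c) :
    ContDiffOn ℝ (⊤ : ℕ∞) g {v | ∀ x, 0 < T v x} := by
  have : CompleteSpace V := FiniteDimensional.complete ℝ V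
  intro P hP
  obtain ⟨hQ, hc⟩ := hg P hP
  have hF := contDiffAt_momentMap (T := T) (ℓ := ℓ) (u := (P, g P)) (n := ⊤) hQ
  have hne : ((⊤ : ℕ∞) : WithTop ℕ∞) ≠ 0 := by simp
  have hinv : (fderiv ℝ (momentMap T ℓ) (P, g P) ∘L .inr ℝ V V).IsInvertible := by
    refine isInvertible_of_injective finrank_continuousDual _ fun v hv => ?_
    rw [fderiv_momentMap_comp_inr_apply hQ, neg_eq_zero] at hv
    exact momentCLM_injective hℓ (fun x =>
      mul_pos (hP x) (mul_pos (ringInverse_pos hQ x) (ringInverse_pos hQ x))) hv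
  have hG := hF.contDiffAt_implicitFunction hne hinv
  refine (hG.congr_of_eventuallyEq ?_).contDiffWithinAt
  have hpos := hG.continuousAt.eventually_mem (s := {v | ∀ x, 0 < T v x})
    ((isOpen_pos).mem_nhds (by rw [hF.implicitFunction_apply_self hne hinv]; exact hQ))
  filter_upwards [hF.eventually_apply_implicitFunction hne hinv, hpos,
    (isOpen_pos).mem_nhds hP] with p h1 h2 h3
  exact momentMap_injective_right hℓ h3 (hg p h3).1 h2 ((hg p h3).2.trans (hc.symm.trans h1.symm))

end MomentMap

/-! ### Trigonometric polynomials -/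

section Trigonometric

variable {d : ℕ} {Λ : Finset (Fin d → ℤ)}

theorem continuous_dotP (k : Fin d → ℤ) : Continuous (dotP d k) := by
  unfold dotP
  fun_prop

theorem continuous_evalE (p : {k // k ∈ Λ} → ℂ) : Continuous (evalE d Λ p) := by
  have := fun k : {k // k ∈ Λ} => continuous_dotP (k : Fin d → ℤ)
  unfold evalE
  fun_prop

theorem dotP_neg (k : Fin d → ℤ) (θ : Fin d → ℝ) : dotP d (-k) θ = -dotP d k θ := by
  simp [dotP]

theorem exists_mem_Td_evalE_eq (θ : Fin d → ℝ) :
    ∃ θ' ∈ Td d, ∀ p : {k // k ∈ Λ} → ℂ, evalE d Λ p θ = evalE d Λ p θ' := by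
  refine ⟨fun j => toIocMod Real.two_pi_pos (-Real.pi) (θ j), fun j _ => ?_, fun p => ?_⟩
  · have h := toIocMod_mem_Ioc Real.two_pi_pos (-Real.pi) (θ j)
    rwa [show -Real.pi + 2 * Real.pi = Real.pi by ring] at h
  · unfold evalE
    congr 1
    refine Finset.sum_congr rfl fun k _ => ?_
    congr 1
    set n : Fin d → ℤ := fun j => toIocDiv Real.two_pi_pos (-Real.pi) (θ j) with hn
    have hθ : dotP d k θ = dotP d k (fun j => toIocMod Real.two_pi_pos (-Real.pi) (θ j)) +
        ((∑ j, (k : Fin d → ℤ) j * n j : ℤ) : ℝ) * (2 * Real.pi) := by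
      simp only [dotP]
      push_cast
      rw [Finset.sum_mul, ← Finset.sum_add_distrib]
      refine Finset.sum_congr rfl fun j _ => ?_
      conv_lhs => rw [← toIocMod_add_toIocDiv_zsmul Real.two_pi_pos (-Real.pi) (θ j)]
      rw [zsmul_eq_mul]
      ring
    rw [Complex.exp_eq_exp_iff_exists_int]
    refine ⟨-∑ j, (k : Fin d → ℤ) j * n j, ?_⟩
    rw [hθ]
    push_cast
    ring

theorem evalE_pos {p : {k // k ∈ Λ} → ℂ} (hp : p ∈ PplusE d Λ) (θ : Fin d → ℝ) :
    0 < evalE d Λ p θ := by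
  obtain ⟨θ', hθ', h⟩ := exists_mem_Td_evalE_eq (Λ := Λ) θ
  rw [h]
  exact hp.2 θ' hθ'

/-- The trigonometric monomial `θ ↦ e^{-i(k,θ)}` as a character. -/
def trigChar (d : ℕ) (k : Fin d → ℤ) : Multiplicative (Fin d → ℝ) →* ℂ where
  toFun θ := Complex.exp (-(dotP d k θ.toAdd : ℂ) * Complex.I)
  map_one' := by simp [dotP]
  map_mul' x y := by
    rw [← Complex.exp_add]
    congr 1
    simp only [dotP, toAdd_mul, Pi.add_apply, mul_add, Finset.sum_add_distrib]
    push_cast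
    ring

theorem trigChar_injective : Function.Injective (trigChar d) := by
  intro k l h
  by_contra hkl
  obtain ⟨j, hj⟩ := Function.ne_iff.1 hkl
  have hne : ((k j : ℝ) - l j) ≠ 0 := sub_ne_zero.2 (by exact_mod_cast hj)
  have h1 := DFunLike.congr_fun h
    (Multiplicative.ofAdd (Pi.single j (Real.pi / ((k j : ℝ) - l j))))
  have hs : ∀ m : Fin d → ℤ, ∀ t : ℝ, dotP d m (Pi.single j t) = m j * t := fun m t => by
    simp [dotP, Pi.single_apply]
  simp only [trigChar, MonoidHom.coe_mk, OneHom.coe_mk, toAdd_ofAdd, hs] at h1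
  rw [Complex.exp_eq_exp_iff_exists_int] at h1
  obtain ⟨n, hn⟩ := h1
  have h2 : -((k j : ℝ) * (Real.pi / (k j - l j))) =
      -((l j : ℝ) * (Real.pi / (k j - l j))) + n * (2 * Real.pi) := by
    have hn' : ((-((k j : ℝ) * (Real.pi / (k j - l j))) : ℝ) : ℂ) * Complex.I =
        ((-((l j : ℝ) * (Real.pi / (k j - l j))) + n * (2 * Real.pi) : ℝ) : ℂ) * Complex.I := by
      push_cast at hn ⊢
      rw [hn]
      ring
    exact_mod_cast mul_right_cancel₀ Complex.I_ne_zero hn'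
  have h3 : Real.pi * (1 + 2 * n) = 0 := by
    have h4 : ((k j : ℝ) - l j) * (Real.pi / (k j - l j)) = Real.pi := by field_simp
    linarith
  have h5 : (1 + 2 * n : ℤ) = 0 := by
    exact_mod_cast (mul_eq_zero.1 h3).resolve_left Real.pi_ne_zero
  omega

theorem sum_im_eq_zero (hΛ : ∀ k ∈ Λ, -k ∈ Λ) {p : {k // k ∈ Λ} → ℂ} (hp : symmE d Λ p)
    (θ : Fin d → ℝ) :
    (∑ k : {k // k ∈ Λ}, p k * Complex.exp (-(dotP d k θ : ℂ) * Complex.I)).im = 0 := by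
  rw [← Complex.conj_eq_iff_im, map_sum]
  let e : {k // k ∈ Λ} ≃ {k // k ∈ Λ} :=
    (Equiv.neg (Fin d → ℤ)).subtypeEquiv fun k =>
      ⟨hΛ k, fun h => by simpa using hΛ _ h⟩
  refine Fintype.sum_equiv e _ _ fun k => ?_
  have h1 : p (e k) = starRingEnd ℂ (p k) := hp k (hΛ k k.2)
  have h2 : dotP d (e k) θ = -dotP d k θ := dotP_neg k θ
  rw [h1, h2, map_mul, ← Complex.exp_conj]
  simp

theorem eq_zero_of_evalE_eq_zero (hΛ : ∀ k ∈ Λ, -k ∈ Λ) {p : {k // k ∈ Λ} → ℂ}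
    (hp : symmE d Λ p) (h : ∀ θ, evalE d Λ p θ = 0) : p = 0 := by
  have hli : LinearIndependent ℂ (fun k : {k // k ∈ Λ} =>
      (trigChar d k : Multiplicative (Fin d → ℝ) → ℂ)) :=
    (linearIndependent_monoidHom (Multiplicative (Fin d → ℝ)) ℂ).comp
      (fun k : {k // k ∈ Λ} => trigChar d k) (trigChar_injective.comp Subtype.val_injective)
  funext k
  refine Fintype.linearIndependent_iff.1 hli p ?_ k
  funext θ
  have h1 := Complex.ext (z := ∑ k : {k // k ∈ Λ}, p k *
    Complex.exp (-(dotP d k θ.toAdd : ℂ) * Complex.I)) (w := 0) (h θ.toAdd)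
    (sum_im_eq_zero hΛ hp θ.toAdd)
  simpa [Finset.sum_apply, trigChar] using h1

theorem Td_subset_closure_interior : Td d ⊆ closure (interior (Td d)) := by
  have h : -Real.pi ≠ Real.pi := by linarith [Real.pi_pos]
  rw [Td, interior_pi_set Set.finite_univ, closure_pi_set]
  refine Set.pi_mono fun j _ => ?_
  rw [interior_Ioc, closure_Ioo h]
  exact Set.Ioc_subset_Icc_self

theorem eq_zero_of_ae_evalE_eq_zero (hΛ : ∀ k ∈ Λ, -k ∈ Λ) {p : {k // k ∈ Λ} → ℂ}
    (hp : symmE d Λ p) (h : ∀ᵐ θ ∂dm d, evalE d Λ p θ = 0) : p = 0 := by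
  have hc : (ENNReal.ofReal ((2 * Real.pi) ^ d))⁻¹ ≠ 0 :=
    ENNReal.inv_ne_zero.2 ENNReal.ofReal_ne_top
  rw [dm, Measure.ae_ennreal_smul_measure_iff hc] at h
  have h1 : Set.EqOn (evalE d Λ p) (fun _ => 0) (Td d) :=
    Measure.eqOn_of_ae_eq h (continuous_evalE p).continuousOn continuousOn_const
      Td_subset_closure_interior
  refine eq_zero_of_evalE_eq_zero hΛ hp fun θ => ?_
  obtain ⟨θ', hθ', hθ⟩ := exists_mem_Td_evalE_eq (Λ := Λ) θ
  rw [hθ]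
  exact h1 hθ'

/-! ### The torus as a compact space -/

/-- The closed cube `[-π, π]^d`. -/
def cube (d : ℕ) : Set (Fin d → ℝ) := Set.univ.pi fun _ => Set.Icc (-Real.pi) Real.pi

instance : CompactSpace (cube d) :=
  isCompact_iff_compactSpace.1 (isCompact_univ_pi fun _ => isCompact_Icc)

theorem measurableSet_cube : MeasurableSet (cube d) :=
  MeasurableSet.univ_pi fun _ => measurableSet_Icc

theorem dm_restrict_cube : (dm d).restrict (cube d) = dm d := by
  have h : Td d ⊆ cube d := Set.pi_mono fun _ _ => Set.Ioc_subset_Icc_self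
  rw [dm, Measure.restrict_smul, Measure.restrict_restrict measurableSet_cube,
    Set.inter_eq_right.2 h]

/-- The measure `dm` on the closed cube. -/
def cubeMeasure (d : ℕ) : Measure (cube d) := (dm d).comap Subtype.val

theorem integral_cubeMeasure (f : (Fin d → ℝ) → ℝ) :
    ∫ x : cube d, f x ∂cubeMeasure d = ∫ θ, f θ ∂dm d := by
  rw [cubeMeasure, integral_subtype_comap measurableSet_cube, dm_restrict_cube]

instance : IsFiniteMeasure (dm d) := by
  have hT : volume (Td d) < ⊤ := by
    rw [Td, Real.volume_pi_Ioc]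
    exact ENNReal.prod_lt_top fun _ _ => ENNReal.ofReal_lt_top
  have : IsFiniteMeasure (volume.restrict (Td d)) := ⟨by simpa using hT⟩
  refine Measure.smul_finite _ (ENNReal.inv_ne_top.2 ?_)
  have := Real.pi_pos
  simp only [ne_eq, ENNReal.ofReal_eq_zero, not_le]
  positivity

instance : IsFiniteMeasure (cubeMeasure d) :=
  ⟨by
    rw [cubeMeasure, (MeasurableEmbedding.subtype_coe measurableSet_cube).comap_apply]
    exact measure_lt_top _ _⟩

theorem integrable_cubeMeasure (f : C(cube d, ℝ)) : Integrable f (cubeMeasure d) :=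
  (BoundedContinuousFunction.mkOfCompact f).integrable (cubeMeasure d)

/-- Integration against `dm` as a functional on continuous functions. -/
def integralFunctional (d : ℕ) : C(cube d, ℝ) →L[ℝ] ℝ :=
  LinearMap.mkContinuous
    { toFun := fun f => ∫ x, f x ∂cubeMeasure d
      map_add' := fun f g => integral_add (integrable_cubeMeasure f) (integrable_cubeMeasure g)
      map_smul' := fun a f => integral_const_mul a f }
    ((cubeMeasure d).real univ) fun f => by
      rw [mul_comm]
      exact norm_integral_le_of_norm_le_const (Filter.Eventually.of_forall f.norm_coe_le_norm)

theorem integralFunctional_apply (f : C(cube d, ℝ)) :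
    integralFunctional d f = ∫ x, f x ∂cubeMeasure d := rfl

/-! ### The space of conjugate-symmetric coefficient sequences -/

variable (d Λ) in
/-- The real vector space of conjugate-symmetric coefficient sequences. -/
def symmSubmodule : Submodule ℝ ({k // k ∈ Λ} → ℂ) where
  carrier := {p | symmE d Λ p}
  zero_mem' := fun k h => by simp
  add_mem' := fun {p q} hp hq k h => by simp [hp k h, hq k h]
  smul_mem' := fun a p hp k h => by simp [hp k h]

/-- The symmetrization `p ↦ (p_k + conj p_{-k}) / 2`. -/
def symmetrize (hΛ : ∀ k ∈ Λ, -k ∈ Λ) : ({k // k ∈ Λ} → ℂ) →ₗ[ℝ] symmSubmodule d Λ where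
  toFun p := ⟨fun k => (1 / 2 : ℝ) • (p k + starRingEnd ℂ (p ⟨-k, hΛ k k.2⟩)), fun k h => by
    simp only [neg_neg, Complex.real_smul, map_mul, map_add, Complex.conj_ofReal,
      Complex.conj_conj]
    rw [add_comm]⟩
  map_add' p q := by
    ext k
    simp
    ring
  map_smul' a p := by
    ext k
    simp
    ring

theorem symmetrize_of_symm (hΛ : ∀ k ∈ Λ, -k ∈ Λ) {p : {k // k ∈ Λ} → ℂ} (hp : symmE d Λ p) :
    symmetrize hΛ p = ⟨p, hp⟩ := by
  ext k
  simp only [symmetrize, LinearMap.coe_mk, AddHom.coe_mk, hp k (hΛ k k.2), Complex.conj_conj]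
  simp
  ring

variable (d Λ) in
/-- Evaluation of trigonometric polynomials on the closed cube. -/
def evalCLM : symmSubmodule d Λ →L[ℝ] C(cube d, ℝ) :=
  LinearMap.toContinuousLinearMap
    { toFun := fun p => ⟨fun x => evalE d Λ p x, (continuous_evalE _).comp continuous_subtype_val⟩
      map_add' := fun p q => by
        ext x
        simp [evalE, add_mul, Finset.sum_add_distrib]
      map_smul' := fun a p => by
        ext x
        simp only [evalE, Submodule.coe_smul, Pi.smul_apply, smul_mul_assoc, ← Finset.smul_sum]
        exact Complex.smul_re a _ }

@[simp]
theorem evalCLM_apply (p : symmSubmodule d Λ) (x : cube d) :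
    evalCLM d Λ p x = evalE d Λ p x := rfl

theorem evalCLM_pos_iff (p : symmSubmodule d Λ) :
    (∀ x, 0 < evalCLM d Λ p x) ↔ (p : {k // k ∈ Λ} → ℂ) ∈ PplusE d Λ :=
  ⟨fun h => ⟨p.2, fun θ hθ => h ⟨θ, fun j hj => Set.Ioc_subset_Icc_self (hθ j hj)⟩⟩,
    fun h x => evalE_pos h x⟩

theorem eq_zero_of_weighted_integral_eq_zero (hΛ : ∀ k ∈ Λ, -k ∈ Λ) (w : C(cube d, ℝ))
    (v : symmSubmodule d Λ) (hw : ∀ x, 0 < w x)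
    (h : integralFunctional d (w * evalCLM d Λ v * evalCLM d Λ v) = 0) : v = 0 := by
  rw [integralFunctional_apply, integral_eq_zero_iff_of_nonneg
    (fun x => by
      simp only [ContinuousMap.mul_apply, mul_assoc, Pi.zero_apply]
      exact mul_nonneg (hw x).le (mul_self_nonneg _))
    (integrable_cubeMeasure _)] at h
  have h1 : ∀ᵐ x ∂cubeMeasure d, evalE d Λ v (x : cube d) = 0 := by
    filter_upwards [h] with x hx
    simpa [(hw x).ne'] using hx
  refine Subtype.ext (eq_zero_of_ae_evalE_eq_zero hΛ v.2 ?_)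
  rw [← dm_restrict_cube, ← Subtype.range_coe (s := cube d),
    ← (MeasurableEmbedding.subtype_coe measurableSet_cube).map_comap,
    (MeasurableEmbedding.subtype_coe measurableSet_cube).ae_map_iff]
  exact h1

variable (d Λ) in
/-- The pairing `⟨c, ·⟩` as a functional on symmetric sequences. -/
def pairCLM (c : {k // k ∈ Λ} → ℂ) : symmSubmodule d Λ →L[ℝ] ℝ :=
  LinearMap.toContinuousLinearMap
    { toFun := fun p => pairE d Λ c p
      map_add' := fun p q => by
        simp [pairE, mul_add, Finset.sum_add_distrib]
      map_smul' := fun a p => by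
        simp only [pairE, Complex.re_sum, RingHom.id_apply, smul_eq_mul,
          Finset.mul_sum]
        refine Finset.sum_congr rfl fun k _ => ?_
        simp
        ring }

theorem momentMap_eq_pairCLM {c : {k // k ∈ Λ} → ℂ} {P Q : symmSubmodule d Λ}
    (hQ : ∀ x, 0 < evalCLM d Λ Q x)
    (hc : ∀ k : {k // k ∈ Λ}, c k =
      ∫ θ, Complex.exp ((dotP d (k : Fin d → ℤ) θ : ℂ) * Complex.I) *
        ((evalE d Λ P θ / evalE d Λ Q θ : ℝ) : ℂ) ∂(dm d)) :
    momentMap (evalCLM d Λ) (integralFunctional d) (P, Q) = pairCLM d Λ c := by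
  have hpos := evalE_pos ((evalCLM_pos_iff Q).1 hQ)
  ext R
  have hcont : Continuous fun θ => evalE d Λ P θ / evalE d Λ Q θ :=
    (continuous_evalE _).div (continuous_evalE _) fun θ => (hpos θ).ne'
  have hint : ∀ k : {k // k ∈ Λ}, Integrable (fun θ =>
      Complex.exp ((dotP d (k : Fin d → ℤ) θ : ℂ) * Complex.I) *
        ((evalE d Λ P θ / evalE d Λ Q θ : ℝ) : ℂ) * starRingEnd ℂ (R.1 k)) (dm d) := fun k => by
    have hk := continuous_dotP (k : Fin d → ℤ)
    have hf : Continuous (fun θ => Complex.exp ((dotP d (k : Fin d → ℤ) θ : ℂ) * Complex.I) *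
        ((evalE d Λ P θ / evalE d Λ Q θ : ℝ) : ℂ) * starRingEnd ℂ (R.1 k)) := by
      have := Complex.continuous_ofReal.comp hcont
      simp only [Function.comp_def] at this
      fun_prop
    rw [← dm_restrict_cube]
    exact hf.continuousOn.integrableOn_compact (isCompact_univ_pi fun _ => isCompact_Icc)
  have h1 : pairCLM d Λ c R = ∫ θ, evalE d Λ P θ / evalE d Λ Q θ * evalE d Λ R θ ∂dm d := by
    change (∑ k, c k * starRingEnd ℂ (R.1 k)).re = _
    simp only [hc, ← integral_mul_const]
    rw [← integral_finsetSum _ fun k _ => hint k]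
    refine (integral_re (integrable_finsetSum _ fun k _ => hint k)).symm.trans ?_
    refine integral_congr_ae (Filter.Eventually.of_forall fun θ => ?_)
    simp only [evalE, Complex.re_sum, Finset.mul_sum, RCLike.re_to_complex]
    refine Finset.sum_congr rfl fun k _ => ?_
    rw [mul_right_comm, Complex.re_mul_ofReal, mul_comm, ← Complex.conj_re]
    simp [← Complex.exp_conj, mul_comm]
  rw [h1, ← integral_cubeMeasure]
  change integralFunctional d _ = _
  rw [integralFunctional_apply]
  refine integral_congr_ae (Filter.Eventually.of_forall fun x => ?_)
  simp [ringInverse_apply hQ, div_eq_mul_inv]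

end Trigonometric

/-- for d ≤ 2 and fixed c ∈ ℭ₊, the map g^c : 𝔓₊ → 𝔓₊ sending P to
the unique Q ∈ 𝔓₊ with c_k = ∫ e^{i(k,θ)}(P/Q) dm for all k ∈ Λ (i.e. any map g
satisfying this characterization on 𝔓₊) is a diffeomorphism onto its image 𝔔₊ ⊆ 𝔓₊:
it is injective and smooth, and its inverse on the image is smooth. -/
theorem statement13 (d : ℕ) (hd1 : 1 ≤ d) (hd2 : d ≤ 2) (Λ : Finset (Fin d → ℤ))
    (h0 : (0 : Fin d → ℤ) ∈ Λ) (hΛ : ∀ k ∈ Λ, -k ∈ Λ)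
    (c : {k // k ∈ Λ} → ℂ) (hc : c ∈ CplusE d Λ)
    (g : ({k // k ∈ Λ} → ℂ) → ({k // k ∈ Λ} → ℂ))
    (hg : ∀ P ∈ PplusE d Λ, g P ∈ PplusE d Λ ∧
      ∀ k : {k // k ∈ Λ}, c k =
        ∫ θ, Complex.exp ((dotP d (k : Fin d → ℤ) θ : ℂ) * Complex.I) *
          ((evalE d Λ P θ / evalE d Λ (g P) θ : ℝ) : ℂ) ∂(dm d)) :
    Set.InjOn g (PplusE d Λ) ∧
    ContDiffOn ℝ (⊤ : ℕ∞) g (PplusE d Λ) ∧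
    ∃ h : ({k // k ∈ Λ} → ℂ) → ({k // k ∈ Λ} → ℂ),
      Set.InvOn h g (PplusE d Λ) (g '' PplusE d Λ) ∧
      ContDiffOn ℝ (⊤ : ℕ∞) h (g '' PplusE d Λ) := by
  have hℓ := eq_zero_of_weighted_integral_eq_zero (d := d) hΛ
  set π := LinearMap.toContinuousLinearMap (symmetrize hΛ)
  have hπ_apply : ∀ p (hp : symmE d Λ p), π p = ⟨p, hp⟩ := fun p hp => symmetrize_of_symm hΛ hp
  have hmaps : MapsTo π (PplusE d Λ) {v | ∀ x, 0 < evalCLM d Λ v x} := fun p hp => by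
    rw [mem_ofPred_eq, evalCLM_pos_iff, hπ_apply p hp.1]
    exact hp
  have hext : ∀ f : symmSubmodule d Λ → symmSubmodule d Λ,
      ContDiffOn ℝ (⊤ : ℕ∞) f {v | ∀ x, 0 < evalCLM d Λ v x} →
      ContDiffOn ℝ (⊤ : ℕ∞) (fun p => (f (π p) : {k // k ∈ Λ} → ℂ)) (PplusE d Λ) := fun f hf =>
    (symmSubmodule d Λ).subtypeL.contDiff.comp_contDiffOn (hf.comp π.contDiff.contDiffOn hmaps)
  have hmoment : ∀ P : symmSubmodule d Λ, (∀ x, 0 < evalCLM d Λ P x) →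
      (∀ x, 0 < evalCLM d Λ (π (g P)) x) ∧
      momentMap (evalCLM d Λ) (integralFunctional d) (P, π (g P)) = pairCLM d Λ c := fun P hP => by
    obtain ⟨hgP, hcP⟩ := hg P ((evalCLM_pos_iff P).1 hP)
    refine ⟨hmaps hgP, momentMap_eq_pairCLM (hmaps hgP) ?_⟩
    rw [hπ_apply _ hgP.1]
    exact hcP
  obtain ⟨h, hh, hleft⟩ := exists_smooth_left_inverse hℓ (pairCLM d Λ c)
  have hinv : LeftInvOn (fun q => (h (π q) : {k // k ∈ Λ} → ℂ)) g (PplusE d Λ) := fun p hp => by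
    have hp' := hmoment ⟨p, hp.1⟩ ((evalCLM_pos_iff _).2 hp)
    simp only [hleft _ _ hp'.1 hp'.2]
  refine ⟨hinv.injOn, ?_, _, ⟨hinv, ?_⟩, (hext h hh).mono ?_⟩
  · refine (hext _ (contDiffOn_of_momentMap_eq hℓ (pairCLM d Λ c) _ hmoment)).congr fun p hp => ?_
    rw [hπ_apply p hp.1, hπ_apply _ (hg p hp).1.1]
  · exact hinv.rightInvOn_image
  · rintro _ ⟨p, hp, rfl⟩
    exact (hg p hp).1

end RCE
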